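/- Let b > 1, let δ be defined from the Fibonacci word, let ρ = (500b/(b−1))·(b(1−δ)+1), and let f : ℝ → ℝ be defined by f(x) = x/b + 1000 if x < ρ and f(x) = x/b + 500 if x ≥ ρ. Let K = [500b(2−δ)/(b−1), 500b(3−δ−1/b)/(b−1)]. Then there exists a Cantor set C ⊂ K such that ω_f(x) = C for every x ∈ ℝ. -/

import Mathlib

open Filter Topology

noncomputable def phiGolden : ℝ := (1 + Real.sqrt 5) / 2

noncomputable def fibWord (k : ℕ) : ℤ :=
  2 + ⌊((k : ℝ) + 1) * phiGolden⌋ - ⌊((k : ℝ) + 2) * phiGolden⌋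

noncomputable def fibDelta (b : ℝ) : ℝ :=
  1 - 1 / b + (1 / b) * (1 - 1 / b) * ∑' k : ℕ, (fibWord k : ℝ) * (1 / b) ^ k

noncomputable def rhoParam (b : ℝ) : ℝ :=
  500 * b / (b - 1) * (b * (1 - fibDelta b) + 1)

noncomputable def pwc (r v₁ v₂ ρ : ℝ) (x : ℝ) : ℝ :=
  if x < ρ then (1 + r) * x + v₁ else (1 + r) * x + v₂

def omegaLim (g : ℝ → ℝ) (x : ℝ) : Set ℝ :=
  {p : ℝ | ∃ n : ℕ → ℕ, StrictMono n ∧ Tendsto (fun k => g^[n k] x) atTop (𝓝 p)}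

def IsCantorSet (C : Set ℝ) : Prop :=
  C.Nonempty ∧ IsCompact C ∧ Perfect C ∧ IsNowhereDense C

def IsPeriodicSeq (a : ℕ → ℝ) : Prop := ∃ n ≥ 1, ∀ i, a (i + n) = a i

def AsymptoticTo (s a : ℕ → ℝ) : Prop :=
  Tendsto (fun n => |s n - a n|) atTop (𝓝 0)

open scoped Classical in
noncomputable def visitCount (g : ℝ → ℝ) (x : ℝ) (J : Set ℝ) (N : ℕ) : ℕ :=
  ((Finset.range N).filter (fun n => g^[n] x ∈ J)).card

noncomputable def alphaRot : ℝ := (3 - Real.sqrt 5) / 2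

noncomputable def Trot (x : ℝ) : ℝ :=
  if x < 1 - alphaRot then x + alphaRot else x + alphaRot - 1

noncomputable def gmap (b : ℝ) (x : ℝ) : ℝ :=
  if x < b * (1 - fibDelta b) then x / b + fibDelta b else x / b + fibDelta b - 1

noncomputable def fmap (b : ℝ) (x : ℝ) : ℝ :=
  if x < rhoParam b then x / b + 1000 else x / b + 500

noncomputable def Kset (b : ℝ) : Set ℝ :=
  Set.Icc (500 * b / (b - 1) * (2 - fibDelta b))
    (500 * b / (b - 1) * (3 - fibDelta b - 1 / b))

section Aux

theorem aux_dense (α : ℝ) (hα : Irrational α) (a c : ℝ) (hac : a < c) (N : ℕ) :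
    ∃ n : ℕ, N ≤ n ∧ ∃ m : ℤ, a < n * α + m ∧ n * α + m < c := by
  have : Fact ((0:ℝ) < 1) := ⟨one_pos⟩
  have hd : DenseRange (· • (α : AddCircle (1:ℝ)) : ℤ → AddCircle (1:ℝ)) :=
    AddCircle.denseRange_zsmul_coe_iff.2 (by simpa using hα)
  obtain ⟨t, ht⟩ := exists_between hac
  have hcl : MapClusterPt (t : AddCircle (1:ℝ)) atTop
      (fun n : ℕ => n • (α : AddCircle (1:ℝ))) :=
    ((mapClusterPt_atTop_nsmul_tfae (t : AddCircle (1:ℝ)) (α : AddCircle (1:ℝ))).out 0 3).2 (hd _)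
  have hopen : IsOpen ((fun x : ℝ => (x : AddCircle (1:ℝ))) '' Set.Ioo a c) :=
    QuotientAddGroup.isOpenMap_coe _ isOpen_Ioo
  have hfr := (mapClusterPt_iff_frequently.1 hcl) _ (hopen.mem_nhds ⟨t, ht, rfl⟩)
  obtain ⟨n, hn, s, hs, hsn⟩ := (frequently_atTop.1 hfr) N
  refine ⟨n, hn, ?_⟩
  have h2 : ((n * α : ℝ) : AddCircle (1:ℝ)) = (s : AddCircle (1:ℝ)) := by
    refine Eq.trans ?_ hsn.symm
    rw [← nsmul_eq_mul]; rfl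
  obtain ⟨m, hm⟩ := (QuotientAddGroup.eq_iff_sub_mem.1 h2)
  refine ⟨-m, ?_⟩
  simp at hm
  have : (n * α + ((-m : ℤ) : ℝ)) = s := by push_cast; linarith
  rw [this]; exact hs

noncomputable def Psi (β α y : ℝ) : ℝ :=
  (1 - β) * ∑' k : ℕ, β ^ k * ((⌊y - (k + 1) * α⌋ : ℝ) - ⌊- ((k + 1) * α)⌋)

theorem aux_floor_bd (y c : ℝ) : |((⌊y - c⌋ : ℝ) - ⌊-c⌋)| ≤ |y| + 1 := by
  have h1 := Int.floor_le (y - c)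
  have h2 := Int.lt_floor_add_one (y - c)
  have h3 := Int.floor_le (-c)
  have h4 := Int.lt_floor_add_one (-c)
  have := le_abs_self y
  have := neg_abs_le y
  rw [abs_le]; constructor <;> linarith

variable {β α : ℝ}

theorem aux_summable (h0 : 0 < β) (h1 : β < 1) (y : ℝ) (c : ℕ → ℝ) :
    Summable (fun k : ℕ => β ^ k * ((⌊y - c k⌋ : ℝ) - ⌊- c k⌋)) := by
  refine Summable.of_norm_bounded (g := fun k : ℕ => β ^ k * (|y| + 1))
    ((summable_geometric_of_lt_one h0.le h1).mul_right _) (fun k => ?_)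
  rw [norm_mul, Real.norm_eq_abs, Real.norm_eq_abs, abs_of_nonneg (by positivity)]
  exact mul_le_mul_of_nonneg_left (aux_floor_bd _ _) (by positivity)

theorem Psi_add_int (h0 : 0 < β) (h1 : β < 1) (y : ℝ) (m : ℤ) :
    Psi β α (y + m) = Psi β α y + m := by
  have : ∀ k : ℕ, β ^ k * ((⌊y + m - (k + 1) * α⌋ : ℝ) - ⌊- ((k + 1) * α)⌋)
      = β ^ k * ((⌊y - (k + 1) * α⌋ : ℝ) - ⌊- ((k + 1) * α)⌋) + β ^ k * m := by
    intro k
    rw [show y + m - (k + 1) * α = y - (k + 1) * α + m by ring, Int.floor_add_intCast]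
    push_cast; ring
  unfold Psi
  simp_rw [this]
  rw [Summable.tsum_add (aux_summable h0 h1 y _)
    ((summable_geometric_of_lt_one h0.le h1).mul_right _), tsum_mul_right,
    tsum_geometric_of_lt_one h0.le h1]
  have : (1 - β) ≠ 0 := by linarith
  rw [mul_add, ← mul_assoc (1 - β) _ (m : ℝ), mul_inv_cancel₀ this, one_mul]

theorem Psi_zero : Psi β α 0 = 0 := by
  simp [Psi]

theorem Psi_int (h0 : 0 < β) (h1 : β < 1) (m : ℤ) : Psi β α m = m := by
  have := Psi_add_int (α := α) h0 h1 0 m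
  simpa [Psi_zero] using this

theorem Psi_shift (h0 : 0 < β) (h1 : β < 1) (y : ℝ) :
    Psi β α (y + α) = β * Psi β α y + Psi β α α + (1 - β) * ⌊y⌋ := by
  have key : Psi β α (y + α) - Psi β α α = β * Psi β α y + (1 - β) * ⌊y⌋ := by
    unfold Psi
    rw [← mul_sub, ← Summable.tsum_sub (aux_summable h0 h1 _ _) (aux_summable h0 h1 _ _),
      Summable.tsum_eq_zero_add ((aux_summable h0 h1 _ _).sub (aux_summable h0 h1 _ _))]
    have : ∀ k : ℕ, β ^ (k + 1) * ((⌊y + α - (((k + 1 : ℕ) : ℝ) + 1) * α⌋ : ℝ)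
          - ⌊- ((((k + 1 : ℕ) : ℝ) + 1) * α)⌋)
        - β ^ (k + 1) * ((⌊α - (((k + 1 : ℕ) : ℝ) + 1) * α⌋ : ℝ)
          - ⌊- ((((k + 1 : ℕ) : ℝ) + 1) * α)⌋)
        = β * (β ^ k * ((⌊y - (k + 1) * α⌋ : ℝ) - ⌊- ((k + 1) * α)⌋)) := by
      intro k
      rw [show y + α - (((k + 1 : ℕ) : ℝ) + 1) * α = y - (k + 1) * α by push_cast; ring,
        show α - (((k + 1 : ℕ) : ℝ) + 1) * α = - ((k + 1) * α) by push_cast; ring]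
      ring
    simp_rw [this]
    rw [tsum_mul_left]
    simp
    ring
  linarith

theorem Psi_gap (h0 : 0 < β) (h1 : β < 1) (u v : ℝ) (k : ℕ) (m : ℤ)
    (hu : u < m + (k + 1) * α) (hv : m + (k + 1) * α ≤ v) :
    Psi β α u + (1 - β) * β ^ k ≤ Psi β α v := by
  have huv : u ≤ v := by linarith
  unfold Psi
  rw [← mul_add]
  refine mul_le_mul_of_nonneg_left ?_ (by linarith)
  have hs := (aux_summable h0 h1 v (fun k => (k + 1) * α)).sub
    (aux_summable h0 h1 u (fun k => (k + 1) * α))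
  have hle := hs.le_tsum k (fun j _ => by
    rw [← mul_sub]
    refine mul_nonneg (by positivity) ?_
    have : (⌊u - (j + 1) * α⌋ : ℝ) ≤ ⌊v - (j + 1) * α⌋ := by
      exact_mod_cast Int.floor_le_floor (by linarith)
    linarith)
  rw [Summable.tsum_sub (aux_summable h0 h1 _ _) (aux_summable h0 h1 _ _)] at hle
  have a1 : ⌊u - (k + 1) * α⌋ < m := Int.floor_lt.2 (by linarith)
  have a2 : m ≤ ⌊v - (k + 1) * α⌋ := Int.le_floor.2 (by linarith)
  have a3 : (1 : ℝ) ≤ (⌊v - (k + 1) * α⌋ : ℝ) - ⌊u - (k + 1) * α⌋ := by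
    have : (1 : ℤ) ≤ ⌊v - (k + 1) * α⌋ - ⌊u - (k + 1) * α⌋ := by omega
    exact_mod_cast this
  have a4 : β ^ k * 1 ≤ β ^ k * ((⌊v - (k + 1) * α⌋ : ℝ) - ⌊u - (k + 1) * α⌋) :=
    mul_le_mul_of_nonneg_left a3 (by positivity)
  have a5 : β ^ k * (⌊v - (k + 1) * α⌋ - ⌊- ((k + 1) * α)⌋ : ℝ)
      - β ^ k * (⌊u - (k + 1) * α⌋ - ⌊- ((k + 1) * α)⌋ : ℝ)
      = β ^ k * ((⌊v - (k + 1) * α⌋ : ℝ) - ⌊u - (k + 1) * α⌋) := by ring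
  linarith

theorem aux_jump (hα : Irrational α) (u v : ℝ) (huv : u < v) :
    ∃ (k : ℕ) (m : ℤ), u < m + (k + 1) * α ∧ m + (k + 1) * α < v := by
  obtain ⟨n, hn, m, h1, h2⟩ := aux_dense α hα u v huv 1
  obtain ⟨k, rfl⟩ : ∃ k, n = k + 1 := ⟨n - 1, by omega⟩
  refine ⟨k, m, ?_, ?_⟩ <;> push_cast at h1 h2 <;> linarith

theorem Psi_strictMono (h0 : 0 < β) (h1 : β < 1) (hα : Irrational α) :
    StrictMono (Psi β α) := by
  intro u v huv
  obtain ⟨k, m, a, b⟩ := aux_jump hα u v huv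
  have := Psi_gap h0 h1 u v k m a b.le
  have : 0 < (1 - β) * β ^ k := mul_pos (by linarith) (by positivity)
  linarith

theorem Psi_right (h0 : 0 < β) (h1 : β < 1) (z : ℝ) :
    Tendsto (Psi β α) (𝓝[>] z) (𝓝 (Psi β α z)) := by
  unfold Psi
  refine Tendsto.const_mul _ ?_
  refine tendsto_tsum_of_dominated_convergence (bound := fun k : ℕ => β ^ k * (|z| + 1 + 1))
    ((summable_geometric_of_lt_one h0.le h1).mul_right _) ?_ ?_
  · intro k
    refine Tendsto.const_mul _ (Tendsto.sub_const ?_ _)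
    have hf := tendsto_floor_right_pure_floor (z - (k + 1) * α)
    have hs : Tendsto (fun u : ℝ => u - (k + 1) * α) (𝓝[>] z) (𝓝[≥] (z - (k + 1) * α)) := by
      refine tendsto_nhdsWithin_iff.2 ⟨?_, ?_⟩
      · exact ((continuous_id.sub continuous_const).tendsto z).mono_left nhdsWithin_le_nhds
      · filter_upwards [self_mem_nhdsWithin] with u hu
        simp only [Set.mem_Ioi] at hu
        simp only [Set.mem_Ici]; linarith
    have h3 := hf.comp hs
    refine tendsto_const_nhds.congr' ?_
    filter_upwards [tendsto_pure.1 h3] with u hu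
    simp only [Function.comp] at hu
    rw [hu]
  · filter_upwards [Ioo_mem_nhdsGT (show z < z + 1 by linarith)] with u hu k
    rw [norm_mul, Real.norm_eq_abs, Real.norm_eq_abs, abs_of_nonneg (by positivity)]
    refine mul_le_mul_of_nonneg_left ((aux_floor_bd _ _).trans ?_) (by positivity)
    have : |u| ≤ |z| + 1 := by
      have := neg_abs_le z
      have := le_abs_self z
      rw [abs_le]; constructor <;> linarith [hu.1, hu.2]
    linarith

theorem Psi_floor (h0 : 0 < β) (h1 : β < 1) (hα : Irrational α) (y : ℝ) :
    ⌊Psi β α y⌋ = ⌊y⌋ := by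
  have hm := Psi_strictMono h0 h1 hα
  rw [Int.floor_eq_iff]
  constructor
  · rw [← Psi_int (α := α) h0 h1]; exact hm.monotone (Int.floor_le y)
  · have := hm (Int.lt_floor_add_one y)
    have h2 := Psi_int (α := α) h0 h1 (⌊y⌋ + 1)
    push_cast at h2
    linarith

theorem Psi_fract (h0 : 0 < β) (h1 : β < 1) (y : ℝ) :
    Psi β α (Int.fract y) = Psi β α y - ⌊y⌋ := by
  have := Psi_add_int (α := α) h0 h1 (Int.fract y) ⌊y⌋
  rw [Int.fract_add_floor] at this
  linarith

theorem cantor_of (h0 : 0 < β) (h1 : β < 1) (hα : Irrational α) (A B : ℝ) (hA : 0 < A) :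
    IsCantorSet (closure ((fun u => A * Psi β α u + B) '' Set.Ico 0 1)) := by
  have hm := Psi_strictMono h0 h1 hα
  refine ⟨?_, ?_, ?_, ?_⟩
  · exact ⟨_, subset_closure ⟨0, by simp, rfl⟩⟩
  · refine (isCompact_Icc (a := B) (b := A + B)).closure_of_subset ?_
    rintro _ ⟨u, hu, rfl⟩
    have a1 := hm.monotone hu.1
    have a2 := hm.monotone hu.2.le
    have := Psi_int (α := α) h0 h1 1
    rw [Psi_zero] at a1
    push_cast at this
    rw [this] at a2
    constructor
    · have := mul_nonneg hA.le a1
      simp only; linarith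
    · have := mul_le_mul_of_nonneg_left a2 hA.le
      simp only; linarith
  · refine Preperfect.perfect_closure ?_
    rintro _ ⟨z, hz, rfl⟩
    rw [accPt_iff_frequently]
    have ht : Tendsto (fun u => A * Psi β α u + B) (𝓝[>] z) (𝓝 (A * Psi β α z + B)) :=
      ((Psi_right h0 h1 z).const_mul A).add_const B
    refine ht.frequently ?_
    refine Eventually.frequently ?_
    filter_upwards [Ioo_mem_nhdsGT hz.2] with u hu
    refine ⟨?_, u, ⟨hz.1.trans hu.1.le, hu.2⟩, rfl⟩
    have := mul_lt_mul_of_pos_left (hm hu.1) hA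
    intro h; linarith
  · rw [isClosed_closure.isNowhereDense_iff]
    by_contra hne
    obtain ⟨p, hp⟩ := Set.nonempty_iff_ne_empty.2 hne
    obtain ⟨_, hq, z, hz, rfl⟩ := mem_closure_iff.1 (interior_subset hp) _ isOpen_interior hp
    have ht : Tendsto (fun u => A * Psi β α u + B) (𝓝[>] z) (𝓝 (A * Psi β α z + B)) :=
      ((Psi_right h0 h1 z).const_mul A).add_const B
    obtain ⟨ε, hε, hball⟩ := Metric.isOpen_iff.1 isOpen_interior _ hq
    obtain ⟨w, hw1, hw2⟩ := ((ht.eventually (Metric.ball_mem_nhds _ hε)).and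
      self_mem_nhdsWithin).exists
    have hw2 : z < w := hw2
    obtain ⟨k, m, hk1, hk2⟩ := aux_jump hα z w hw2
    set y : ℝ := m + (k + 1) * α with hy
    set g : ℝ := (1 - β) * β ^ k with hg
    have hgpos : 0 < g := mul_pos (by linarith) (by positivity)
    have hAg : 0 < A * g := mul_pos hA hgpos
    have hzy := Psi_gap h0 h1 z y k m hk1 le_rfl
    have hyw := hm hk2
    have e1 := mul_le_mul_of_nonneg_left hzy hA.le
    have e2 := mul_lt_mul_of_pos_left hyw hA
    rw [← hg, mul_add] at e1
    rw [Real.dist_eq, abs_lt] at hw1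
    have hmem : A * Psi β α y + B - A * g / 2 ∈ closure ((fun u => A * Psi β α u + B) '' Set.Ico 0 1) := by
      refine interior_subset (hball ?_)
      rw [Metric.mem_ball, Real.dist_eq, abs_lt]
      constructor <;> linarith
    obtain ⟨_, hs, u, hu, rfl⟩ := mem_closure_iff.1 hmem
      (Set.Ioo (A * Psi β α y + B - A * g) (A * Psi β α y + B)) isOpen_Ioo
      ⟨by linarith, by linarith⟩
    simp only [Set.mem_Ioo] at hs
    rcases lt_or_ge u y with h | h
    · have := mul_le_mul_of_nonneg_left (Psi_gap h0 h1 u y k m h le_rfl) hA.le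
      linarith [hs.1]
    · have := mul_le_mul_of_nonneg_left (hm.monotone h) hA.le
      linarith [hs.2]

theorem omega_of (h0 : 0 < β) (h1 : β < 1) (hα : Irrational α) (A B : ℝ)
    (F : ℝ → ℝ) (x y : ℝ)
    (hF : Tendsto (fun n : ℕ => F^[n] x - (A * Psi β α (Int.fract (y + n * α)) + B)) atTop (𝓝 0)) :
    omegaLim F x = closure ((fun u => A * Psi β α u + B) '' Set.Ico 0 1) := by
  have hset : omegaLim F x = {p | MapClusterPt p atTop (fun n => F^[n] x)} := by
    ext p
    constructor
    · rintro ⟨n, hn, ht⟩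
      exact MapClusterPt.of_comp hn.tendsto_atTop ht.mapClusterPt
    · intro h
      obtain ⟨n, hn, ht⟩ := MapClusterPt.tendsto_subseq h
      exact ⟨n, hn, ht⟩
  apply Set.Subset.antisymm
  · rintro p ⟨n, hn, ht⟩
    have h2 := ht.sub (hF.comp hn.tendsto_atTop)
    rw [sub_zero] at h2
    refine mem_closure_of_tendsto h2 (Eventually.of_forall fun k => ?_)
    refine ⟨Int.fract (y + n k * α), ⟨Int.fract_nonneg _, Int.fract_lt_one _⟩, ?_⟩
    simp only [Function.comp]; ring
  · rw [hset]
    refine closure_minimal ?_ isClosed_setOfPred_clusterPt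
    rintro _ ⟨z, hz, rfl⟩
    have ht : Tendsto (fun u => A * Psi β α u + B) (𝓝[>] z) (𝓝 (A * Psi β α z + B)) :=
      ((Psi_right h0 h1 z).const_mul A).add_const B
    refine (Metric.nhds_basis_ball.mapClusterPt_iff_frequently).2 ?_
    intro ε hε
    rw [frequently_atTop]
    intro N
    obtain ⟨N', hN'⟩ := eventually_atTop.1 (Metric.tendsto_nhds.1 hF (ε / 2) (by linarith))
    have hev := (ht.eventually (Metric.ball_mem_nhds _ (half_pos hε))).and (Ioo_mem_nhdsGT hz.2)
    obtain ⟨w, hw, hwI⟩ := (mem_nhdsGT_iff_exists_Ioo_subset).1 hev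
    have hw : z < w := hw
    obtain ⟨n, hn, m, hm1, hm2⟩ := aux_dense α hα (z - y) (w - y) (by linarith) (max N N')
    have hI := hwI (show y + n * α + m ∈ Set.Ioo z w from ⟨by linarith, by linarith⟩)
    have hfr : Int.fract (y + n * α) = y + n * α + m := by
      rw [← Int.fract_add_intCast (y + n * α) m]
      exact Int.fract_eq_self.2 ⟨hz.1.trans hI.2.1.le, hI.2.2⟩
    refine ⟨n, (le_max_left _ _).trans hn, ?_⟩
    have b1 := hN' n ((le_max_right _ _).trans hn)
    have b2 := hI.1
    rw [hfr, Real.dist_eq, sub_zero, abs_lt] at b1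
    simp only [Metric.mem_ball, Real.dist_eq] at b2 ⊢
    rw [abs_lt] at b2 ⊢
    constructor <;> linarith [b1.1, b1.2, b2.1, b2.2]

noncomputable def Glift (β δ X : ℝ) : ℝ := β * X + δ + (1 - β) * ⌊X⌋

noncomputable def gn (β δ x : ℝ) : ℝ := if β * x + δ < 1 then β * x + δ else β * x + δ - 1

theorem Glift_mono (h0 : 0 < β) (h1 : β < 1) (δ : ℝ) : Monotone (Glift β δ) := by
  intro u v huv
  unfold Glift
  have a1 : (⌊u⌋ : ℝ) ≤ ⌊v⌋ := by exact_mod_cast Int.floor_le_floor huv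
  have a2 := mul_le_mul_of_nonneg_left a1 (show 0 ≤ 1 - β by linarith)
  have a3 := mul_le_mul_of_nonneg_left huv h0.le
  linarith

theorem Glift_iter_Psi (h0 : 0 < β) (h1 : β < 1) (hα : Irrational α) (n : ℕ) (u : ℝ) :
    (Glift β (Psi β α α))^[n] (Psi β α u) = Psi β α (u + n * α) := by
  induction n with
  | zero => simp
  | succ n ih =>
    rw [Function.iterate_succ_apply', ih]
    push_cast
    rw [show u + (n + 1) * α = (u + n * α) + α by ring, Psi_shift h0 h1, Glift,
      Psi_floor h0 h1 hα]

theorem gn_mem {δ : ℝ} (h0 : 0 < β) (h1 : β < 1) (d0 : 0 < δ) (d1 : δ < 1) {s : ℝ}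
    (hs : 0 ≤ s) (hs1 : s < 1) : 0 ≤ gn β δ s ∧ gn β δ s < 1 := by
  have : 0 ≤ β * s := by positivity
  have : β * s < 1 := by nlinarith
  unfold gn
  split_ifs <;> constructor <;> linarith

theorem gn_fract {δ : ℝ} (h0 : 0 < β) (h1 : β < 1) (d0 : 0 < δ) (d1 : δ < 1) (X : ℝ) :
    gn β δ (Int.fract X) = Int.fract (Glift β δ X) := by
  symm
  have hm := gn_mem h0 h1 d0 d1 (Int.fract_nonneg X) (Int.fract_lt_one X)
  rw [Int.fract_eq_iff]
  refine ⟨hm.1, hm.2, ?_⟩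
  have hX := Int.fract_add_floor X
  have e : Glift β δ X = β * Int.fract X + δ + ⌊X⌋ := by
    unfold Glift
    have : β * X = β * Int.fract X + β * ⌊X⌋ := by rw [← mul_add, hX]
    linarith
  rw [e]
  unfold gn
  split_ifs
  · exact ⟨⌊X⌋, by ring⟩
  · exact ⟨⌊X⌋ + 1, by push_cast; ring⟩

theorem gn_iter_fract {δ : ℝ} (h0 : 0 < β) (h1 : β < 1) (d0 : 0 < δ) (d1 : δ < 1) (X : ℝ)
    (n : ℕ) : (gn β δ)^[n] (Int.fract X) = Int.fract ((Glift β δ)^[n] X) := by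
  induction n with
  | zero => simp
  | succ n ih =>
    rw [Function.iterate_succ_apply', Function.iterate_succ_apply', ih, gn_fract h0 h1 d0 d1]

theorem asymp_unit (h0 : 0 < β) (h1 : β < 1) (hα : Irrational α)
    (d0 : 0 < Psi β α α) (d1 : Psi β α α < 1) (x : ℝ) (hx : 0 ≤ x) (hx1 : x < 1) :
    ∃ y : ℝ, Tendsto (fun n : ℕ => (gn β (Psi β α α))^[n] x - Psi β α (Int.fract (y + n * α)))
      atTop (𝓝 0) := by
  have hm := Psi_strictMono h0 h1 hα
  set G := Glift β (Psi β α α) with hG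
  have hGm : Monotone G := Glift_mono h0 h1 _
  set S : Set ℝ := {z | x ≤ Psi β α z} with hS
  have hbd : BddBelow S := by
    refine ⟨0, fun z hz => ?_⟩
    by_contra h
    have := hm (not_le.1 h)
    rw [Psi_zero] at this
    have hz : x ≤ Psi β α z := hz
    linarith
  have hne : S.Nonempty := by
    refine ⟨1, ?_⟩
    have := Psi_int (α := α) h0 h1 1
    push_cast at this
    show x ≤ Psi β α 1
    linarith
  set y := sInf S with hy
  have hlow : ∀ u, u < y → Psi β α u ≤ x := by
    intro u hu
    by_contra h
    have : y ≤ u := csInf_le hbd (not_le.1 h).le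
    linarith
  have hup : ∀ v, y < v → x ≤ Psi β α v := by
    intro v hv
    obtain ⟨z, hz, hzv⟩ := exists_lt_of_csInf_lt hne hv
    exact le_trans hz (hm.monotone hzv.le)
  have f1 : ∀ n : ℕ, ∀ u, u < y → ⌊u + n * α⌋ ≤ ⌊G^[n] x⌋ := by
    intro n u hu
    rw [← Psi_floor h0 h1 hα (u + n * α), ← Glift_iter_Psi h0 h1 hα]
    exact Int.floor_le_floor (hGm.iterate n (hlow u hu))
  have f2 : ∀ n : ℕ, ∀ v, y < v → ⌊G^[n] x⌋ ≤ ⌊v + n * α⌋ := by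
    intro n v hv
    rw [← Psi_floor h0 h1 hα (v + n * α), ← Glift_iter_Psi h0 h1 hα]
    exact Int.floor_le_floor (hGm.iterate n (hup v hv))
  have feq : ∀ n : ℕ, (∀ m : ℤ, y + n * α ≠ m) → ⌊G^[n] x⌋ = ⌊y + n * α⌋ := by
    intro n hn
    set w := y + n * α with hw
    have w1 : (⌊w⌋ : ℝ) < w := lt_of_le_of_ne (Int.floor_le w) (hn _).symm
    have w2 := Int.lt_floor_add_one w
    apply le_antisymm
    · obtain ⟨v, hv1, hv2⟩ := exists_between w2
      have := f2 n (v - n * α) (by linarith)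
      rw [sub_add_cancel] at this
      refine this.trans ?_
      have : ⌊v⌋ < ⌊w⌋ + 1 := Int.floor_lt.2 (by push_cast; exact hv2)
      omega
    · have := f1 n (⌊w⌋ - n * α) (by linarith)
      rw [sub_add_cancel, Int.floor_intCast] at this
      exact this
  obtain ⟨N, hN⟩ : ∃ N : ℕ, ∀ n ≥ N, ∀ m : ℤ, y + n * α ≠ m := by
    by_cases hex : ∃ n : ℕ, ∃ m : ℤ, y + n * α = m
    · obtain ⟨n, m, hnm⟩ := hex
      refine ⟨n + 1, fun n' hn' m' h => ?_⟩
      have hne : ((n' : ℤ) - n) ≠ 0 := by omega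
      have hirr := hα.intCast_mul hne
      refine hirr ⟨((m' - m : ℤ) : ℚ), ?_⟩
      push_cast
      linarith
    · push Not at hex
      exact ⟨0, fun n _ m => hex n m⟩
  refine ⟨y, ?_⟩
  have hfl : ∀ n ≥ N, ⌊G^[n] x⌋ = ⌊y + n * α⌋ := fun n hn => feq n (hN n hn)
  have hd : ∀ k : ℕ, G^[k + N] x - Psi β α (y + (k + N : ℕ) * α)
      = β ^ k * (G^[N] x - Psi β α (y + N * α)) := by
    intro k
    induction k with
    | zero => simp
    | succ k ih =>
      rw [pow_succ', mul_assoc, ← ih, show k + 1 + N = (k + N) + 1 by ring,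
        Function.iterate_succ_apply',
        show y + ((k + N + 1 : ℕ) : ℝ) * α = (y + ((k + N : ℕ) : ℝ) * α) + α by push_cast; ring,
        Psi_shift h0 h1, hG, Glift, ← hG, hfl (k + N) (by omega)]
      ring
  rw [← tendsto_add_atTop_iff_nat N]
  have hlim : Tendsto (fun k : ℕ => β ^ k * (G^[N] x - Psi β α (y + N * α))) atTop (𝓝 0) := by
    have := (tendsto_pow_atTop_nhds_zero_of_lt_one h0.le h1).mul_const
      (G^[N] x - Psi β α (y + N * α))
    simpa using this
  refine hlim.congr fun k => ?_
  rw [← hd k, Psi_fract h0 h1]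
  have hxf : Int.fract x = x := Int.fract_eq_self.2 ⟨hx, hx1⟩
  have := gn_iter_fract h0 h1 d0 d1 x (k + N)
  rw [hxf] at this
  rw [this, ← Int.self_sub_floor, ← hG, hfl (k + N) (by omega)]
  ring

theorem enter_low {δ : ℝ} (h0 : 0 < β) (h1 : β < 1) (d0 : 0 < δ) (d1 : δ < 1) (N : ℕ) :
    ∀ x : ℝ, -(N * δ) ≤ x → x < 1 → ∃ n, 0 ≤ (gn β δ)^[n] x ∧ (gn β δ)^[n] x < 1 := by
  induction N with
  | zero => intro x h h'; exact ⟨0, by simpa using h, by simpa using h'⟩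
  | succ N ih =>
    intro x h h'
    rcases le_or_gt 0 x with hx | hx
    · exact ⟨0, by simpa using hx, by simpa using h'⟩
    · have e1 : β * x < 0 := by nlinarith
      have e2 : x < β * x := by nlinarith
      have e3 : gn β δ x = β * x + δ := by
        unfold gn; rw [if_pos (by linarith)]
      push_cast at h
      obtain ⟨n, hn⟩ := ih (gn β δ x) (by rw [e3]; linarith) (by rw [e3]; linarith)
      exact ⟨n + 1, by simpa [Function.iterate_succ_apply] using hn⟩

theorem enter_high {δ : ℝ} (h0 : 0 < β) (h1 : β < 1) (d1 : δ < 1) (hbd : 1 < β + δ)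
    (N : ℕ) :
    ∀ x : ℝ, 0 ≤ x → x < 1 + N * (1 - δ) → ∃ n, 0 ≤ (gn β δ)^[n] x ∧ (gn β δ)^[n] x < 1 := by
  induction N with
  | zero => intro x h h'; exact ⟨0, by simpa using h, by simpa using h'⟩
  | succ N ih =>
    intro x h h'
    rcases lt_or_ge x 1 with hx | hx
    · exact ⟨0, by simpa using h, by simpa using hx⟩
    · have e1 : β ≤ β * x := by nlinarith
      have e2 : β * x < x := by nlinarith
      have e3 : gn β δ x = β * x + δ - 1 := by
        unfold gn; rw [if_neg (by linarith)]
      push_cast at h'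
      obtain ⟨n, hn⟩ := ih (gn β δ x) (by rw [e3]; linarith) (by rw [e3]; linarith)
      exact ⟨n + 1, by simpa [Function.iterate_succ_apply] using hn⟩

theorem asymp_all (h0 : 0 < β) (h1 : β < 1) (hα : Irrational α)
    (a0 : 0 < α) (a1 : α < 1) (x : ℝ) :
    ∃ y : ℝ, Tendsto (fun n : ℕ => (gn β (Psi β α α))^[n] x - Psi β α (Int.fract (y + n * α)))
      atTop (𝓝 0) := by
  have hm := Psi_strictMono h0 h1 hα
  have p1 : Psi β α 1 = 1 := by
    have := Psi_int (α := α) h0 h1 1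
    simpa using this
  have d0 : 0 < Psi β α α := by simpa [Psi_zero] using hm a0
  have d1 : Psi β α α < 1 := by simpa [p1] using hm a1
  have hbd : 1 < β + Psi β α α := by
    have h := Psi_shift (α := α) h0 h1 (1 - α)
    have hf : ⌊1 - α⌋ = 0 := Int.floor_eq_zero_iff.2 ⟨by linarith, by linarith⟩
    rw [sub_add_cancel, p1, hf] at h
    have h2 : Psi β α (1 - α) < 1 := by
      rw [← p1]; exact hm (by linarith)
    have h3 := mul_lt_mul_of_pos_left h2 h0
    push_cast at h
    linarith
  obtain ⟨N, hN0, hN1⟩ : ∃ n, 0 ≤ (gn β (Psi β α α))^[n] x ∧ (gn β (Psi β α α))^[n] x < 1 := by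
    rcases lt_or_ge x 0 with hx | hx
    · obtain ⟨N, hN⟩ := exists_nat_gt (-x / Psi β α α)
      rw [div_lt_iff₀ d0] at hN
      exact enter_low h0 h1 d0 d1 N x (by linarith) (by linarith)
    · obtain ⟨N, hN⟩ := exists_nat_gt (x / (1 - Psi β α α))
      rw [div_lt_iff₀ (by linarith)] at hN
      exact enter_high h0 h1 d1 hbd N x hx (by linarith)
  obtain ⟨y, hy⟩ := asymp_unit h0 h1 hα d0 d1 _ hN0 hN1
  refine ⟨y - N * α, ?_⟩
  rw [← tendsto_add_atTop_iff_nat N]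
  refine hy.congr fun k => ?_
  rw [← Function.iterate_add_apply, show y - N * α + ((k + N : ℕ) : ℝ) * α = y + k * α by
    push_cast; ring]

theorem delta_eq (b : ℝ) (hb : 1 < b) :
    Psi (1 / b) (2 - phiGolden) (2 - phiGolden) = fibDelta b := by
  have h0 : 0 < 1 / b := by positivity
  have h1 : 1 / b < 1 := by rw [div_lt_one (by linarith)]; exact hb
  have s5 : Real.sqrt 5 < 3 := by rw [Real.sqrt_lt' (by norm_num)]; norm_num
  have s5' : 1 < Real.sqrt 5 := by rw [Real.lt_sqrt (by norm_num)]; norm_num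
  unfold Psi fibDelta
  rw [Summable.tsum_eq_zero_add (aux_summable h0 h1 _ _)]
  have hk : ∀ k : ℕ, (1 / b) ^ (k + 1) * ((⌊2 - phiGolden - (((k + 1 : ℕ) : ℝ) + 1) *
      (2 - phiGolden)⌋ : ℝ) - ⌊- ((((k + 1 : ℕ) : ℝ) + 1) * (2 - phiGolden))⌋)
      = (1 / b) * ((fibWord k : ℝ) * (1 / b) ^ k) := by
    intro k
    have e1 : 2 - phiGolden - (((k + 1 : ℕ) : ℝ) + 1) * (2 - phiGolden)
        = ((k : ℝ) + 1) * phiGolden + ((-(2 * (k + 1)) : ℤ) : ℝ) := by push_cast; ring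
    have e2 : - ((((k + 1 : ℕ) : ℝ) + 1) * (2 - phiGolden))
        = ((k : ℝ) + 2) * phiGolden + ((-(2 * (k + 2)) : ℤ) : ℝ) := by push_cast; ring
    rw [e1, e2, Int.floor_add_intCast, Int.floor_add_intCast, fibWord]
    push_cast
    ring
  simp_rw [hk]
  rw [tsum_mul_left]
  have hfl : ⌊- ((((0 : ℕ) : ℝ) + 1) * (2 - phiGolden))⌋ = -1 := by
    rw [Int.floor_eq_iff]
    unfold phiGolden
    push_cast
    constructor <;> linarith
  have hfl0 : ⌊2 - phiGolden - (((0 : ℕ) : ℝ) + 1) * (2 - phiGolden)⌋ = 0 := by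
    rw [show 2 - phiGolden - (((0 : ℕ) : ℝ) + 1) * (2 - phiGolden) = 0 by push_cast; ring]
    simp
  rw [hfl, hfl0]
  push_cast
  ring

theorem aux_conj (b : ℝ) (hb : 1 < b) (s : ℝ) :
    500 * gn (1 / b) (fibDelta b) s + 500 * b / (b - 1) * (2 - fibDelta b)
      = fmap b (500 * s + 500 * b / (b - 1) * (2 - fibDelta b)) := by
  have hb1 : b - 1 ≠ 0 := by linarith
  have hb0 : 0 < b := by linarith
  have hρ : rhoParam b = 500 * (b * (1 - fibDelta b)) + 500 * b / (b - 1) * (2 - fibDelta b) := by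
    unfold rhoParam
    field_simp
    ring
  have hiff : (500 * s + 500 * b / (b - 1) * (2 - fibDelta b) < rhoParam b)
      ↔ (1 / b * s + fibDelta b < 1) := by
    rw [hρ]
    have : 1 / b * s + fibDelta b < 1 ↔ s / b < 1 - fibDelta b := by
      rw [one_div_mul_eq_div]; constructor <;> intro h <;> linarith
    rw [this, div_lt_iff₀ hb0]
    constructor <;> intro h <;> linarith
  unfold gn fmap
  by_cases h : 1 / b * s + fibDelta b < 1
  · rw [if_pos h, if_pos (hiff.2 h)]
    field_simp
    ring
  · rw [if_neg h, if_neg (fun h' => h (hiff.1 h'))]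
    field_simp
    ring

end Aux

theorem stmt10 (b : ℝ) (hb : 1 < b) :
    ∃ C : Set ℝ, IsCantorSet C ∧ C ⊆ Kset b ∧
      ∀ x : ℝ, omegaLim (fmap b) x = C := by
  have h0 : 0 < 1 / b := by positivity
  have h1 : 1 / b < 1 := by rw [div_lt_one (by linarith)]; exact hb
  have s5 : Real.sqrt 5 < 3 := by rw [Real.sqrt_lt' (by norm_num)]; norm_num
  have s5' : 1 < Real.sqrt 5 := by rw [Real.lt_sqrt (by norm_num)]; norm_num
  have hα : Irrational (2 - phiGolden) := by
    have h : Irrational phiGolden := Real.goldenRatio_irrational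
    have := h.intCast_sub 2
    simpa using this
  have a0 : 0 < 2 - phiGolden := by unfold phiGolden; linarith
  have a1 : 2 - phiGolden < 1 := by unfold phiGolden; linarith
  have hδ := delta_eq b hb
  set B := 500 * b / (b - 1) * (2 - fibDelta b) with hB
  refine ⟨closure ((fun u => 500 * Psi (1 / b) (2 - phiGolden) u + B) '' Set.Ico 0 1),
    cantor_of h0 h1 hα 500 B (by norm_num), ?_, ?_⟩
  · unfold Kset
    refine closure_minimal ?_ isClosed_Icc
    have hK : 500 * b / (b - 1) * (3 - fibDelta b - 1 / b) = B + 500 := by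
      have hb1 : b - 1 ≠ 0 := by linarith
      have hb0 : b ≠ 0 := by linarith
      rw [hB]
      field_simp
      ring
    rw [hK]
    rintro _ ⟨u, hu, rfl⟩
    have hm := (Psi_strictMono h0 h1 hα).monotone
    have c1 := hm hu.1
    have c2 := hm hu.2.le
    have c3 := Psi_int (α := 2 - phiGolden) h0 h1 1
    push_cast at c3
    rw [Psi_zero] at c1
    rw [c3] at c2
    constructor
    · simp only; linarith
    · simp only; linarith
  · intro x
    obtain ⟨y, hy⟩ := asymp_all h0 h1 hα a0 a1 ((x - B) / 500)
    refine omega_of h0 h1 hα 500 B (fmap b) x y ?_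
    have hsemi : Function.Semiconj (fun s => 500 * s + B) (gn (1 / b) (fibDelta b)) (fmap b) :=
      fun s => aux_conj b hb s
    have hx : x = (fun s => 500 * s + B) ((x - B) / 500) := by simp only; ring
    have hy2 := hy.const_mul 500
    rw [mul_zero] at hy2
    refine hy2.congr fun n => ?_
    conv_rhs => rw [hx]
    rw [← (hsemi.iterate_right n) ((x - B) / 500), hδ]
    ring
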